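/- Let Γ be an inverse semigroup with zero and x, y ∈ Γ. If x < x·y·x and y < y·x·y, then x < y⁻¹ and y⁻¹ < x. (This is the uniqueness of inverses in the quotient inverse semigroup Γ̃ = Γ/<>.) -/

import Mathlib

/-- An inverse semigroup: a semigroup in which every element `x` has a unique
element `x⁻¹` with `x * x⁻¹ * x = x` and `x⁻¹ * x * x⁻¹ = x⁻¹`. -/
class InverseSemigroup (α : Type*) extends Semigroup α, Inv α where
  mul_inv_mul : ∀ x : α, x * x⁻¹ * x = x
  inv_mul_inv : ∀ x : α, x⁻¹ * x * x⁻¹ = x⁻¹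
  inv_unique : ∀ x y : α, x * y * x = x → y * x * y = y → y = x⁻¹

variable {α : Type*} [InverseSemigroup α]

/-- The natural order on an inverse semigroup: `x ≺ y` iff `x * y⁻¹ = x * x⁻¹`. -/
def prec (x y : α) : Prop := x * y⁻¹ = x * x⁻¹

/-- The idempotents (units) `Γ⁽⁰⁾`: elements `p` with `p = p * p⁻¹`. -/
def IsIdem (p : α) : Prop := p = p * p⁻¹

/-- A zero element: `z * x = z = x * z` for every `x`. -/
def IsZeroEl (z : α) : Prop := ∀ x : α, z * x = z ∧ x * z = z


/-- The relation x < y (w.r.t. the zero z0): every nonzero precessor of x has a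
nonzero common precessor with y. -/
def lt1 (z0 x y : α) : Prop :=
  ∀ w : α, prec w x → w ≠ z0 → ∃ v : α, v ≠ z0 ∧ prec v w ∧ prec v y

namespace InverseSemigroup

theorem inv_inv (x : α) : x⁻¹⁻¹ = x :=
  (inv_unique x⁻¹ x (inv_mul_inv x) (mul_inv_mul x)).symm

theorem inv_eq_self_of_idem {e : α} (he : e * e = e) : e⁻¹ = e :=
  (inv_unique e e (by rw [he, he]) (by rw [he, he])).symm

theorem mul_idem {e f : α} (he : e * e = e) (hf : f * f = f) :
    (e * f) * (e * f) = e * f := by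
  have hz : f * (e * f)⁻¹ * e = (e * f)⁻¹ := by
    apply inv_unique
    · calc (e * f) * (f * (e * f)⁻¹ * e) * (e * f)
          = e * (f * f) * (e * f)⁻¹ * ((e * e) * f) := by simp only [mul_assoc]
        _ = e * f := by rw [he, hf, mul_inv_mul]
    · calc (f * (e * f)⁻¹ * e) * (e * f) * (f * (e * f)⁻¹ * e)
          = f * ((e * f)⁻¹ * ((e * e) * (f * f)) * (e * f)⁻¹) * e := by simp only [mul_assoc]
        _ = f * (e * f)⁻¹ * e := by rw [he, hf, inv_mul_inv]
  have hzz : (e * f)⁻¹ * (e * f)⁻¹ = (e * f)⁻¹ := by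
    calc (e * f)⁻¹ * (e * f)⁻¹
        = (f * (e * f)⁻¹ * e) * (f * (e * f)⁻¹ * e) := by rw [hz]
      _ = f * ((e * f)⁻¹ * (e * f) * (e * f)⁻¹) * e := by simp only [mul_assoc]
      _ = (e * f)⁻¹ := by rw [inv_mul_inv, hz]
  have h := inv_eq_self_of_idem hzz
  rw [inv_inv] at h
  rw [← h] at hzz
  exact hzz

theorem idem_comm {e f : α} (he : e * e = e) (hf : f * f = f) : e * f = f * e := by
  rw [← inv_eq_self_of_idem (mul_idem he hf)]
  symm
  apply inv_unique
  · calc (e * f) * (f * e) * (e * f) = e * (f * f) * ((e * e) * f) := by simp only [mul_assoc]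
      _ = e * f := by rw [he, hf, mul_idem he hf]
  · calc (f * e) * (e * f) * (f * e) = f * (e * e) * ((f * f) * e) := by simp only [mul_assoc]
      _ = f * e := by rw [he, hf, mul_idem hf he]

theorem mul_inv_idem (x : α) : (x * x⁻¹) * (x * x⁻¹) = x * x⁻¹ := by
  rw [← mul_assoc, mul_inv_mul]

theorem inv_mul_idem (x : α) : (x⁻¹ * x) * (x⁻¹ * x) = x⁻¹ * x := by
  rw [← mul_assoc, inv_mul_inv]

theorem mul_inv_rev (x y : α) : (x * y)⁻¹ = y⁻¹ * x⁻¹ := by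
  have hc := idem_comm (mul_inv_idem y) (inv_mul_idem x)
  symm
  apply inv_unique
  · calc (x * y) * (y⁻¹ * x⁻¹) * (x * y)
        = x * ((y * y⁻¹) * (x⁻¹ * x)) * y := by simp only [mul_assoc]
      _ = (x * x⁻¹ * x) * (y * y⁻¹ * y) := by rw [hc]; simp only [mul_assoc]
      _ = x * y := by rw [mul_inv_mul, mul_inv_mul]
  · calc (y⁻¹ * x⁻¹) * (x * y) * (y⁻¹ * x⁻¹)
        = y⁻¹ * ((x⁻¹ * x) * (y * y⁻¹)) * x⁻¹ := by simp only [mul_assoc]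
      _ = (y⁻¹ * y * y⁻¹) * (x⁻¹ * x * x⁻¹) := by rw [← hc]; simp only [mul_assoc]
      _ = y⁻¹ * x⁻¹ := by rw [inv_mul_inv, inv_mul_inv]

theorem eq_mul_of_prec {x y : α} (h : prec x y) : y * (x⁻¹ * x) = x := by
  have h' : y * x⁻¹ = x * x⁻¹ := by
    simpa only [mul_inv_rev, inv_inv] using congrArg (·⁻¹) h
  rw [← mul_assoc, h', mul_inv_mul]

theorem prec_mul_idem (y : α) {f : α} (hf : f * f = f) : prec (y * f) y := by
  unfold prec
  rw [mul_inv_rev, inv_eq_self_of_idem hf, mul_assoc, mul_assoc, ← mul_assoc f f, hf]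

theorem idem_mul_prec (y : α) {e : α} (he : e * e = e) : prec (e * y) y := by
  unfold prec
  rw [mul_inv_rev, inv_eq_self_of_idem he]
  calc e * y * y⁻¹ = e * e * (y * y⁻¹) := by rw [he, mul_assoc]
    _ = e * ((y * y⁻¹) * e) := by rw [mul_assoc, idem_comm he (mul_inv_idem y)]
    _ = e * y * (y⁻¹ * e) := by simp only [mul_assoc]

theorem prec_inv {x y : α} (h : prec x y) : prec x⁻¹ y⁻¹ := by
  have hx : x⁻¹ = (x⁻¹ * x) * y⁻¹ := by
    calc x⁻¹ = (y * (x⁻¹ * x))⁻¹ := by rw [eq_mul_of_prec h]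
      _ = (x⁻¹ * x) * y⁻¹ := by rw [mul_inv_rev, inv_eq_self_of_idem (inv_mul_idem x)]
  rw [hx]
  exact idem_mul_prec _ (inv_mul_idem x)

theorem mul_eq_of_prec {x y : α} (h : prec x y) : x * x⁻¹ * y = x := by
  have h' := congrArg (·⁻¹) (eq_mul_of_prec (prec_inv h))
  simpa only [mul_inv_rev, inv_inv] using h'

theorem prec_trans {x y z : α} (hxy : prec x y) (hyz : prec y z) : prec x z := by
  rw [← eq_mul_of_prec hxy, ← eq_mul_of_prec hyz, mul_assoc]
  exact prec_mul_idem z (mul_idem (inv_mul_idem _) (inv_mul_idem _))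

theorem prec_inv_of_prec_mul {v x y : α} (hx : prec v x) (hxyx : prec v (x * y * x)) :
    prec v y⁻¹ := by
  have hvyx : v * y * x = v := by
    calc v * y * x = v * v⁻¹ * x * y * x := by rw [mul_eq_of_prec hx]
      _ = v * v⁻¹ * (x * y * x) := by simp only [mul_assoc]
      _ = v := mul_eq_of_prec hxyx
  have hv : v * y * v = v := by
    calc v * y * v = v * y * (x * (v⁻¹ * v)) := by rw [eq_mul_of_prec hx]
      _ = v * y * x * (v⁻¹ * v) := by simp only [mul_assoc]
      _ = v := by rw [hvyx, ← mul_assoc, mul_inv_mul]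
  have hf : (v * y) * (v * y) = v * y := by rw [← mul_assoc, hv]
  have hinv : y * (v * y) = v⁻¹ := by
    apply inv_unique
    · calc v * (y * (v * y)) * v = (v * y * v) * y * v := by simp only [mul_assoc]
        _ = v := by rw [hv, hv]
    · calc y * (v * y) * v * (y * (v * y)) = y * ((v * y * v) * y * v * y) := by
            simp only [mul_assoc]
        _ = y * (v * y) := by rw [hv, hv]
  have h := prec_inv (prec_mul_idem y hf)
  rwa [hinv, inv_inv] at h

theorem lt1_inv_of_lt1_mul {z0 x y : α} (h : lt1 z0 x (x * y * x)) : lt1 z0 x y⁻¹ := by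
  intro w hwx hw
  obtain ⟨v, hv, hvw, hvx⟩ := h w hwx hw
  exact ⟨v, hv, hvw, prec_inv_of_prec_mul (prec_trans hvw hwx) hvx⟩

theorem inv_zero {z0 : α} (hz : IsZeroEl z0) : z0⁻¹ = z0 :=
  inv_eq_self_of_idem (hz z0).1

theorem lt1_inv {z0 x y : α} (hz : IsZeroEl z0) (h : lt1 z0 x y) : lt1 z0 x⁻¹ y⁻¹ := by
  have hne : ∀ {w : α}, w ≠ z0 → w⁻¹ ≠ z0 := fun {w} hw h0 =>
    hw (by rw [← inv_inv w, h0, inv_zero hz])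
  intro w hwx hw
  have hwx' := prec_inv hwx
  rw [inv_inv] at hwx'
  obtain ⟨v, hv, hvw, hvy⟩ := h w⁻¹ hwx' (hne hw)
  have hvw' := prec_inv hvw
  rw [inv_inv] at hvw'
  exact ⟨v⁻¹, hne hv, hvw', prec_inv hvy⟩

end InverseSemigroup

/-- if x < x·y·x and y < y·x·y then x < y⁻¹ and y⁻¹ < x
(uniqueness of inverses in the quotient Γ̃). -/
theorem stmt12 {z0 : α} (hz : IsZeroEl z0) {x y : α}
    (h1 : lt1 z0 x (x * y * x)) (h2 : lt1 z0 y (y * x * y)) :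
    lt1 z0 x y⁻¹ ∧ lt1 z0 y⁻¹ x := by
  refine ⟨InverseSemigroup.lt1_inv_of_lt1_mul h1, ?_⟩
  have h := InverseSemigroup.lt1_inv hz (InverseSemigroup.lt1_inv_of_lt1_mul h2)
  rwa [InverseSemigroup.inv_inv] at h
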